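/- Let 0 < ε ≤ 1/8. Every point u ∈ ∂U₁ ∪ ∂U₂ has a unique representation u = P^{m−1} A^k v with m ∈ {1,2}, k ∈ {0,1,2}, and v ∈ ℂ³ satisfying ‖v‖ = 1 and |v₂|² + |v₃|² = ε: such (m, k, v) exist, and if P^{m−1}A^k v = P^{m'−1}A^{k'} v' with both triples of this form, then m = m', k = k' and v = v'. -/

import Mathlib

open Matrix

noncomputable section

/-- `ξ = exp(2πi/3)`, a primitive cube root of unity. -/
def ξ : ℂ := Complex.exp (2 * Real.pi * Complex.I / 3)

/-- The cyclic permutation matrix `A`, with rows `(0,1,0)`, `(0,0,1)`, `(1,0,0)`. -/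
def A : Matrix (Fin 3) (Fin 3) ℂ := !![0, 1, 0; 0, 0, 1; 1, 0, 0]

/-- The diagonal matrix `B = diag(1, ξ, ξ²)`. -/
def B : Matrix (Fin 3) (Fin 3) ℂ := !![1, 0, 0; 0, ξ, 0; 0, 0, ξ ^ 2]

/-- The matrix `P = (1/√3)·[[1,ξ,1],[1,1,ξ],[ξ,1,1]]`. -/
def P : Matrix (Fin 3) (Fin 3) ℂ :=
  (((Real.sqrt 3 : ℝ) : ℂ))⁻¹ • !![1, ξ, 1; 1, 1, ξ; ξ, 1, 1]

/-- Euclidean space `ℂ³`. -/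
abbrev E3 := EuclideanSpace ℂ (Fin 3)

/-- Application of a `3 × 3` complex matrix to a vector in `ℂ³`. -/
def app (M : Matrix (Fin 3) (Fin 3) ℂ) (v : E3) : E3 := Matrix.toEuclideanLin M v

/-- The unit sphere `S⁵ ⊆ ℂ³`. -/
abbrev S5 : Set E3 := Metric.sphere (0 : E3) 1

/-- The subset `U₁ = {A^k v : k ∈ ℕ, ‖v‖ = 1, |v₂|² + |v₃|² ≤ ε}` of `S⁵`. -/
def U1 (ε : ℝ) : Set S5 :=
  {w | ∃ (k : ℕ) (v : E3), ‖v‖ = 1 ∧ ‖v 1‖ ^ 2 + ‖v 2‖ ^ 2 ≤ ε ∧ (w : E3) = app (A ^ k) v}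

/-- The subset `U₂ = P · U₁` of `S⁵`. -/
def U2 (ε : ℝ) : Set S5 := {w | ∃ u ∈ U1 ε, (w : E3) = app P (u : E3)}

theorem app_apply (M : Matrix (Fin 3) (Fin 3) ℂ) (v : E3) (i : Fin 3) :
    app M v i = M i 0 * v 0 + M i 1 * v 1 + M i 2 * v 2 := by
  simp [app, Matrix.toLpLin_apply, Matrix.mulVec, dotProduct, Fin.sum_univ_three]

theorem app_mul (M N : Matrix (Fin 3) (Fin 3) ℂ) (v : E3) :
    app (M * N) v = app M (app N v) := by
  simp [app, Matrix.toLpLin_apply, Matrix.mulVec_mulVec]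

theorem app_one (v : E3) : app 1 v = v := by
  simp [app]

theorem continuous_app (M : Matrix (Fin 3) (Fin 3) ℂ) : Continuous (app M) :=
  (Matrix.toEuclideanLin M).continuous_of_finiteDimensional

theorem norm_sq_eq_sum_coord (v : E3) : ‖v‖ ^ 2 = ‖v 0‖ ^ 2 + ‖v 1‖ ^ 2 + ‖v 2‖ ^ 2 := by
  rw [EuclideanSpace.norm_sq_eq, Fin.sum_univ_three]

theorem norm_app_of_conjTranspose_mul {M : Matrix (Fin 3) (Fin 3) ℂ} (hM : Mᴴ * M = 1) (v : E3) :
    ‖app M v‖ = ‖v‖ := by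
  have h : inner ℂ (app M v) (app M v) = inner ℂ v v := by
    nth_rw 4 [← app_one v]
    rw [← hM, app_mul]
    simp only [app]
    rw [Matrix.toEuclideanLin_conjTranspose_eq_adjoint, LinearMap.adjoint_inner_right]
  rw [inner_self_eq_norm_sq_to_K, inner_self_eq_norm_sq_to_K] at h
  exact (sq_eq_sq₀ (norm_nonneg _) (norm_nonneg _)).1 (by exact_mod_cast h)

section Coordinates

open scoped Fin.CommRing

theorem app_A_pow_apply (k : ℕ) (v : E3) (j : Fin 3) :
    app (A ^ k) v j = v (j + (k : Fin 3)) := by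
  induction k generalizing j with
  | zero => simp [app_one]
  | succ k ih =>
    have h : ∀ w : E3, app A w j = w (j + 1) := by
      intro w
      rw [app_apply]
      fin_cases j <;> simp [A]
    rw [pow_succ', app_mul, h, ih, Nat.cast_succ, add_assoc, add_comm 1]

theorem norm_app_A_pow (k : ℕ) (v : E3) : ‖app (A ^ k) v‖ = ‖v‖ := by
  rw [EuclideanSpace.norm_eq, EuclideanSpace.norm_eq]
  congr 1
  simp only [app_A_pow_apply]
  exact Equiv.sum_comp (Equiv.addRight (k : Fin 3)) fun j => ‖v j‖ ^ 2

theorem ξ_pow_three : ξ ^ 3 = 1 := by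
  rw [ξ, ← Complex.exp_nat_mul, ← Complex.exp_two_pi_mul_I]
  congr 1
  push_cast
  ring

theorem one_add_ξ_add_ξ_sq : 1 + ξ + ξ ^ 2 = 0 := by
  have h := (Complex.isPrimitiveRoot_exp 3 (by norm_num)).geom_sum_eq_zero (by norm_num)
  simpa [Finset.sum_range_succ, ξ] using h

theorem norm_ξ : ‖ξ‖ = 1 := Complex.norm_eq_one_of_pow_eq_one ξ_pow_three (by norm_num)

theorem conj_ξ_mul_ξ : (starRingEnd ℂ) ξ * ξ = 1 := by
  rw [← Complex.normSq_eq_conj_mul_self, Complex.normSq_eq_norm_sq, norm_ξ]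
  norm_num

theorem conj_ξ : (starRingEnd ℂ) ξ = ξ ^ 2 := by
  linear_combination ξ ^ 2 * conj_ξ_mul_ξ - (starRingEnd ℂ) ξ * ξ_pow_three

theorem inv_sqrt_three_mul_self :
    ((Real.sqrt 3 : ℝ) : ℂ)⁻¹ * ((Real.sqrt 3 : ℝ) : ℂ)⁻¹ = 1 / 3 := by
  rw [← mul_inv, ← Complex.ofReal_mul, Real.mul_self_sqrt (by norm_num)]
  norm_num

theorem conjTranspose_P_mul_P : Pᴴ * P = 1 := by
  have h1 := one_add_ξ_add_ξ_sq
  have h3 := ξ_pow_three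
  rw [P, conjTranspose_smul, smul_mul_smul_comm, star_inv₀, Complex.star_def, Complex.conj_ofReal,
    inv_sqrt_three_mul_self]
  ext i j
  fin_cases i <;> fin_cases j <;>
    simp [Matrix.mul_apply, Fin.sum_univ_three, conj_ξ] <;>
    first
    | linear_combination h1
    | linear_combination (1 / 3) * h3

theorem P_mul_conjTranspose_P : P * Pᴴ = 1 := mul_eq_one_comm.1 conjTranspose_P_mul_P

theorem norm_app_P_apply_le (w : E3) (i : Fin 3) :
    ‖app P w i‖ ≤ (Real.sqrt 3)⁻¹ * (‖w 0‖ + ‖w 1‖ + ‖w 2‖) := by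
  have h : ∀ j, ‖P i j‖ = (Real.sqrt 3)⁻¹ := by
    intro j
    fin_cases i <;> fin_cases j <;> simp [P, norm_ξ, abs_of_nonneg (Real.sqrt_nonneg 3)]
  rw [app_apply]
  refine norm_add₃_le.trans_eq ?_
  simp only [norm_mul, h]
  ring

/-- The largest squared modulus of a coordinate. -/
def maxCoordSq (w : E3) : ℝ := max (‖w 0‖ ^ 2) (max (‖w 1‖ ^ 2) (‖w 2‖ ^ 2))

theorem continuous_maxCoordSq : Continuous maxCoordSq := by
  unfold maxCoordSq
  fun_prop

theorem le_maxCoordSq (w : E3) (i : Fin 3) : ‖w i‖ ^ 2 ≤ maxCoordSq w := by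
  fin_cases i <;> simp [maxCoordSq]

theorem exists_coord_eq_maxCoordSq (w : E3) : ∃ i, ‖w i‖ ^ 2 = maxCoordSq w := by
  unfold maxCoordSq
  rcases max_choice (‖w 0‖ ^ 2) (max (‖w 1‖ ^ 2) (‖w 2‖ ^ 2)) with h | h
  · exact ⟨0, h.symm⟩
  · rcases max_choice (‖w 1‖ ^ 2) (‖w 2‖ ^ 2) with h' | h'
    · exact ⟨1, by rw [h, h']⟩
    · exact ⟨2, by rw [h, h']⟩

theorem exists_app_A_pow_eq (w : E3) (i : Fin 3) :
    ∃ k < 3, ∃ v : E3, v 0 = w i ∧ ‖v‖ = ‖w‖ ∧ w = app (A ^ k) v := by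
  refine ⟨(-i : Fin 3).val, (-i).isLt, app (A ^ i.val) w, ?_, norm_app_A_pow _ _, ?_⟩
  · simp [app_A_pow_apply]
  · ext j
    simp [app_A_pow_apply]

theorem exists_app_A_pow_eq_of_maxCoordSq {w : E3} (hw : ‖w‖ = 1) :
    ∃ k < 3, ∃ v : E3, ‖v‖ = 1 ∧ ‖v 1‖ ^ 2 + ‖v 2‖ ^ 2 = 1 - maxCoordSq w ∧
      w = app (A ^ k) v := by
  obtain ⟨i, hi⟩ := exists_coord_eq_maxCoordSq w
  obtain ⟨k, hk, v, hv0, hv, rfl⟩ := exists_app_A_pow_eq w i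
  rw [hw] at hv
  refine ⟨k, hk, v, hv, ?_, rfl⟩
  have := norm_sq_eq_sum_coord v
  rw [hv, hv0, hi] at this
  linarith

theorem mem_U1_iff {ε : ℝ} {w : S5} : w ∈ U1 ε ↔ 1 - ε ≤ maxCoordSq (w : E3) := by
  constructor
  · rintro ⟨k, v, hv, hε, hw⟩
    have h := le_maxCoordSq (w : E3) (-(k : Fin 3))
    rw [hw, app_A_pow_apply, neg_add_cancel, ← hw] at h
    have := norm_sq_eq_sum_coord v
    rw [hv] at this
    linarith
  · intro h
    obtain ⟨k, -, v, hv, hs, hw⟩ :=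
      exists_app_A_pow_eq_of_maxCoordSq (mem_sphere_zero_iff_norm.1 w.2)
    exact ⟨k, v, hv, by linarith, hw⟩

theorem norm_app_conjTranspose_P (w : E3) : ‖app Pᴴ w‖ = ‖w‖ :=
  norm_app_of_conjTranspose_mul (by rw [conjTranspose_conjTranspose, P_mul_conjTranspose_P]) w

theorem app_conjTranspose_P_app_P (w : E3) : app Pᴴ (app P w) = w := by
  rw [← app_mul, conjTranspose_P_mul_P, app_one]

theorem app_P_app_conjTranspose_P (w : E3) : app P (app Pᴴ w) = w := by
  rw [← app_mul, P_mul_conjTranspose_P, app_one]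

theorem mem_U2_iff {ε : ℝ} {w : S5} : w ∈ U2 ε ↔ 1 - ε ≤ maxCoordSq (app Pᴴ (w : E3)) := by
  constructor
  · rintro ⟨u, hu, hw⟩
    rw [hw, app_conjTranspose_P_app_P]
    exact mem_U1_iff.1 hu
  · intro h
    refine ⟨⟨app Pᴴ w, ?_⟩, mem_U1_iff.2 h, (app_P_app_conjTranspose_P _).symm⟩
    rw [mem_sphere_zero_iff_norm, norm_app_conjTranspose_P, mem_sphere_zero_iff_norm.1 w.2]

theorem maxCoordSq_eq_of_mem_frontier_U1 {ε : ℝ} {u : S5} (hu : u ∈ frontier (U1 ε)) :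
    maxCoordSq (u : E3) = 1 - ε := by
  have h : U1 ε = {w : S5 | 1 - ε ≤ maxCoordSq (w : E3)} := Set.ext fun _ => mem_U1_iff
  rw [h] at hu
  exact (frontier_le_subset_eq continuous_const
    (continuous_maxCoordSq.comp continuous_subtype_val) hu).symm

theorem maxCoordSq_eq_of_mem_frontier_U2 {ε : ℝ} {u : S5} (hu : u ∈ frontier (U2 ε)) :
    maxCoordSq (app Pᴴ (u : E3)) = 1 - ε := by
  have h : U2 ε = {w : S5 | 1 - ε ≤ maxCoordSq (app Pᴴ (w : E3))} := Set.ext fun _ => mem_U2_iff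
  rw [h] at hu
  exact (frontier_le_subset_eq continuous_const
    (continuous_maxCoordSq.comp ((continuous_app _).comp continuous_subtype_val)) hu).symm

theorem app_A_pow_injective {ε : ℝ} (hε : ε ≤ 1 / 8) {k k' : ℕ} (hk : k < 3) (hk' : k' < 3)
    {v v' : E3} (hv : ‖v‖ = 1) (hs : ‖v 1‖ ^ 2 + ‖v 2‖ ^ 2 = ε)
    (hs' : ‖v' 1‖ ^ 2 + ‖v' 2‖ ^ 2 = ε)
    (h : app (A ^ k) v = app (A ^ k') v') : k = k' ∧ v = v' := by
  have hcoord : ∀ j : Fin 3, v (j + k) = v' (j + k') := fun j => by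
    rw [← app_A_pow_apply, ← app_A_pow_apply, h]
  have hn := norm_sq_eq_sum_coord v
  rw [hv] at hn
  have hkk : (k : Fin 3) = k' := by
    by_contra hne
    have h0 := hcoord (-k)
    rw [neg_add_cancel] at h0
    have hne0 : -(k : Fin 3) + k' ≠ 0 := fun hz => hne (neg_add_eq_zero.1 hz)
    generalize -(k : Fin 3) + k' = j at h0 hne0
    rw [h0] at hn
    have h1 := sq_nonneg ‖v' 1‖
    have h2 := sq_nonneg ‖v' 2‖
    fin_cases j
    · exact hne0 rfl
    · simp only [Fin.mk_one] at hn
      linarith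
    · simp only [Fin.reduceFinMk] at hn
      linarith
  refine ⟨?_, ?_⟩
  · have := congrArg Fin.val hkk
    rwa [Fin.val_cast_of_lt hk, Fin.val_cast_of_lt hk'] at this
  · ext j
    simpa [hkk] using hcoord (j - k')

theorem app_A_pow_ne_app_P {ε : ℝ} (hε : ε ≤ 1 / 8) {k k' : ℕ}
    {v v' : E3} (hv : ‖v‖ = 1) (hs : ‖v 1‖ ^ 2 + ‖v 2‖ ^ 2 = ε)
    (hv' : ‖v'‖ = 1) (hs' : ‖v' 1‖ ^ 2 + ‖v' 2‖ ^ 2 = ε) :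
    app (A ^ k) v ≠ app P (app (A ^ k') v') := by
  intro h
  have hn := norm_sq_eq_sum_coord v
  have hn' := norm_sq_eq_sum_coord v'
  rw [hv] at hn
  rw [hv'] at hn'
  have hle := norm_app_P_apply_le (app (A ^ k') v') (-(k : Fin 3))
  rw [← h, app_A_pow_apply, neg_add_cancel] at hle
  have hsum : ‖app (A ^ k') v' 0‖ + ‖app (A ^ k') v' 1‖ + ‖app (A ^ k') v' 2‖
      = ‖v' 0‖ + ‖v' 1‖ + ‖v' 2‖ := by
    simp only [app_A_pow_apply, ← Fin.sum_univ_three fun j => ‖v' (j + (k' : Fin 3))‖,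
      ← Fin.sum_univ_three fun j => ‖v' j‖]
    exact Equiv.sum_comp (Equiv.addRight (k' : Fin 3)) fun j => ‖v' j‖
  rw [hsum] at hle
  have h0 : ‖v' 0‖ ≤ 1 := by
    nlinarith [sq_nonneg ‖v' 1‖, sq_nonneg ‖v' 2‖]
  have h12 : ‖v' 1‖ + ‖v' 2‖ ≤ 1 / 2 :=
    abs_le_of_sq_le_sq' (by nlinarith [sq_nonneg (‖v' 1‖ - ‖v' 2‖)]) (by norm_num) |>.2
  have hsq := pow_le_pow_left₀ (norm_nonneg (v 0)) hle 2
  rw [mul_pow, inv_pow, Real.sq_sqrt (by norm_num)] at hsq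
  have : (‖v' 0‖ + ‖v' 1‖ + ‖v' 2‖) ^ 2 ≤ (3 / 2) ^ 2 :=
    pow_le_pow_left₀ (by positivity) (by linarith) 2
  linarith

end Coordinates

/-- Every boundary point has a unique representation `P^{m-1} A^k v` with `m ∈ {1,2}`,
`k ∈ {0,1,2}`, `‖v‖ = 1` and `|v₂|² + |v₃|² = ε`. -/
theorem boundary_unique_representation (ε : ℝ) (hε0 : 0 < ε) (hε : ε ≤ 1 / 8) :
    (∀ u : S5, u ∈ frontier (U1 ε) ∪ frontier (U2 ε) →
      ∃ (m k : ℕ) (v : E3), (m = 1 ∨ m = 2) ∧ k < 3 ∧ ‖v‖ = 1 ∧ ‖v 1‖ ^ 2 + ‖v 2‖ ^ 2 = ε ∧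
        (u : E3) = app (P ^ (m - 1) * A ^ k) v) ∧
    (∀ (m m' k k' : ℕ) (v v' : E3), (m = 1 ∨ m = 2) → (m' = 1 ∨ m' = 2) → k < 3 → k' < 3 →
      ‖v‖ = 1 → ‖v 1‖ ^ 2 + ‖v 2‖ ^ 2 = ε → ‖v'‖ = 1 → ‖v' 1‖ ^ 2 + ‖v' 2‖ ^ 2 = ε →
      app (P ^ (m - 1) * A ^ k) v = app (P ^ (m' - 1) * A ^ k') v' →
      m = m' ∧ k = k' ∧ v = v') := by
  refine ⟨?_, ?_⟩
  · rintro u (hu | hu)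
    · obtain ⟨k, hk, v, hv, hs, hw⟩ :=
        exists_app_A_pow_eq_of_maxCoordSq (mem_sphere_zero_iff_norm.1 u.2)
      rw [maxCoordSq_eq_of_mem_frontier_U1 hu, sub_sub_cancel] at hs
      exact ⟨1, k, v, Or.inl rfl, hk, hv, hs, by simpa using hw⟩
    · obtain ⟨k, hk, v, hv, hs, hw⟩ := exists_app_A_pow_eq_of_maxCoordSq
        ((norm_app_conjTranspose_P u).trans (mem_sphere_zero_iff_norm.1 u.2))
      rw [maxCoordSq_eq_of_mem_frontier_U2 hu, sub_sub_cancel] at hs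
      refine ⟨2, k, v, Or.inr rfl, hk, hv, hs, ?_⟩
      rw [Nat.add_one_sub_one, pow_one, app_mul, ← hw, app_P_app_conjTranspose_P]
  · rintro m m' k k' v v' (rfl | rfl) (rfl | rfl) hk hk' hv hs hv' hs' h <;>
      simp only [Nat.sub_self, Nat.add_one_sub_one, pow_zero, pow_one, one_mul, app_mul P] at h
    · exact ⟨rfl, app_A_pow_injective hε hk hk' hv hs hs' h⟩
    · exact absurd h (app_A_pow_ne_app_P hε hv hs hv' hs')
    · exact absurd h.symm (app_A_pow_ne_app_P hε hv' hs' hv hs)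
    · refine ⟨rfl, app_A_pow_injective hε hk hk' hv hs hs' ?_⟩
      rw [← app_conjTranspose_P_app_P (app (A ^ k) v), h, app_conjTranspose_P_app_P]
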